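/- arXiv:2303.08807 — 10 statements merged into one kernel-verified Lean document; each statement's English description precedes it below -/
import Mathlib

section
/- Let F : ℝ³ → ℝ be a C⁴ function of (x,y,p). Then the explicit 2-form ρ on ℝ⁵ associated to the chains of the second order ODE y'' = F(x,y,y') is closed: writing ρ via its antisymmetric coefficient matrix M in the coordinates (x,y,p,b₁,b₂), for all indices 1 ≤ i < j < k ≤ 5 and every point of ℝ⁵ one has ∂ᵢM_{jk} + ∂ⱼM_{ki} + ∂ₖM_{ij} = 0. -/
noncomputable section

/-- Partial derivative of `F : ℝ → ℝ → ℝ → ℝ` in its first variable `x`. -/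
def dX (F : ℝ → ℝ → ℝ → ℝ) : ℝ → ℝ → ℝ → ℝ :=
  fun x y p => deriv (fun t => F t y p) x

/-- Partial derivative in the second variable `y`. -/
def dY (F : ℝ → ℝ → ℝ → ℝ) : ℝ → ℝ → ℝ → ℝ :=
  fun x y p => deriv (fun t => F x t p) y

/-- Partial derivative in the third variable `p`. -/
def dP (F : ℝ → ℝ → ℝ → ℝ) : ℝ → ℝ → ℝ → ℝ :=
  fun x y p => deriv (fun t => F x y t) p

/-- Partial derivative of a function on `ℝⁿ` in the `i`-th coordinate direction. -/
def pdn {n : ℕ} (i : Fin n) (f : (Fin n → ℝ) → ℝ) (q : Fin n → ℝ) : ℝ :=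
  deriv (fun t => f (Function.update q i t)) (q i)

/-- The antisymmetric coefficient matrix of the chain 2-form `ρ` associated to the
second order ODE `y'' = F(x, y, y')`, in the coordinates `(x, y, p, b₁, b₂)` on `ℝ⁵`. -/
def chainM (F : ℝ → ℝ → ℝ → ℝ) (q : Fin 5 → ℝ) : Matrix (Fin 5) (Fin 5) ℝ :=
  let x := q 0
  let y := q 1
  let p := q 2
  let b₁ := q 3
  let b₂ := q 4
  let m12 : ℝ := -(1/6) * dP (dP (dX F)) x y p + (2/3) * dP (dY F) x y p
      + b₁ * dY F x y p - (1/6) * p * dP (dP (dY F)) x y p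
  let m13 : ℝ := b₁ * b₂ + (1/2) * dP (dP F) x y p + b₁ * dP F x y p
      - (1/6) * p * dP (dP (dP F)) x y p
  let m14 : ℝ := p * b₂ + F x y p
  let m15 : ℝ := p * b₁ + 1
  let m23 : ℝ := (1/6) * dP (dP (dP F)) x y p
  let m24 : ℝ := -b₂
  let m25 : ℝ := -b₁
  let m34 : ℝ := -1
  !![0, m12, m13, m14, m15;
     -m12, 0, m23, m24, m25;
     -m13, -m23, 0, m34, 0;
     -m14, -m24, -m34, 0, 0;
     -m15, -m25, 0, 0, 0]

/-- The function on `ℝ × ℝ × ℝ` obtained by uncurrying a function of three variables. -/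
def uncurryThree (F : ℝ → ℝ → ℝ → ℝ) : ℝ × ℝ × ℝ → ℝ := fun q => F q.1 q.2.1 q.2.2

section PartialDerivatives

variable {F : ℝ → ℝ → ℝ → ℝ}

lemma hasDerivAt_fst_fderiv (hF : Differentiable ℝ (uncurryThree F)) (x y p : ℝ) :
    HasDerivAt (fun t => F t y p) (fderiv ℝ (uncurryThree F) (x, y, p) (1, 0, 0)) x :=
  HasFDerivAt.comp_hasDerivAt (f := fun t : ℝ => (t, y, p)) x (hF (x, y, p)).hasFDerivAt
    ((hasDerivAt_id x).prodMk (hasDerivAt_const x (y, p)))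

lemma hasDerivAt_snd_fderiv (hF : Differentiable ℝ (uncurryThree F)) (x y p : ℝ) :
    HasDerivAt (fun t => F x t p) (fderiv ℝ (uncurryThree F) (x, y, p) (0, 1, 0)) y :=
  HasFDerivAt.comp_hasDerivAt (f := fun t : ℝ => (x, t, p)) y (hF (x, y, p)).hasFDerivAt
    ((hasDerivAt_const y x).prodMk ((hasDerivAt_id y).prodMk (hasDerivAt_const y p)))

lemma hasDerivAt_thd_fderiv (hF : Differentiable ℝ (uncurryThree F)) (x y p : ℝ) :
    HasDerivAt (fun t => F x y t) (fderiv ℝ (uncurryThree F) (x, y, p) (0, 0, 1)) p :=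
  HasFDerivAt.comp_hasDerivAt (f := fun t : ℝ => (x, y, t)) p (hF (x, y, p)).hasFDerivAt
    ((hasDerivAt_const p x).prodMk ((hasDerivAt_const p y).prodMk (hasDerivAt_id p)))

lemma hasDerivAt_dX (hF : Differentiable ℝ (uncurryThree F)) (x y p : ℝ) :
    HasDerivAt (fun t => F t y p) (dX F x y p) x :=
  (hasDerivAt_fst_fderiv hF x y p).differentiableAt.hasDerivAt

lemma hasDerivAt_dY (hF : Differentiable ℝ (uncurryThree F)) (x y p : ℝ) :
    HasDerivAt (fun t => F x t p) (dY F x y p) y :=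
  (hasDerivAt_snd_fderiv hF x y p).differentiableAt.hasDerivAt

lemma hasDerivAt_dP (hF : Differentiable ℝ (uncurryThree F)) (x y p : ℝ) :
    HasDerivAt (fun t => F x y t) (dP F x y p) p :=
  (hasDerivAt_thd_fderiv hF x y p).differentiableAt.hasDerivAt

lemma uncurryThree_dX (hF : Differentiable ℝ (uncurryThree F)) :
    uncurryThree (dX F) = fun q => fderiv ℝ (uncurryThree F) q (1, 0, 0) :=
  funext fun q => (hasDerivAt_fst_fderiv hF q.1 q.2.1 q.2.2).deriv

lemma uncurryThree_dY (hF : Differentiable ℝ (uncurryThree F)) :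
    uncurryThree (dY F) = fun q => fderiv ℝ (uncurryThree F) q (0, 1, 0) :=
  funext fun q => (hasDerivAt_snd_fderiv hF q.1 q.2.1 q.2.2).deriv

lemma uncurryThree_dP (hF : Differentiable ℝ (uncurryThree F)) :
    uncurryThree (dP F) = fun q => fderiv ℝ (uncurryThree F) q (0, 0, 1) :=
  funext fun q => (hasDerivAt_thd_fderiv hF q.1 q.2.1 q.2.2).deriv

lemma contDiff_dX {m n : WithTop ℕ∞} (hF : ContDiff ℝ n (uncurryThree F)) (hmn : m + 1 ≤ n) :
    ContDiff ℝ m (uncurryThree (dX F)) := by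
  rw [uncurryThree_dX ((hF.of_le (le_add_self.trans hmn)).differentiable one_ne_zero)]
  exact (hF.fderiv_right hmn).clm_apply contDiff_const

lemma contDiff_dY {m n : WithTop ℕ∞} (hF : ContDiff ℝ n (uncurryThree F)) (hmn : m + 1 ≤ n) :
    ContDiff ℝ m (uncurryThree (dY F)) := by
  rw [uncurryThree_dY ((hF.of_le (le_add_self.trans hmn)).differentiable one_ne_zero)]
  exact (hF.fderiv_right hmn).clm_apply contDiff_const

lemma contDiff_dP {m n : WithTop ℕ∞} (hF : ContDiff ℝ n (uncurryThree F)) (hmn : m + 1 ≤ n) :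
    ContDiff ℝ m (uncurryThree (dP F)) := by
  rw [uncurryThree_dP ((hF.of_le (le_add_self.trans hmn)).differentiable one_ne_zero)]
  exact (hF.fderiv_right hmn).clm_apply contDiff_const

/-- Directional derivatives of a `C²` function commute. -/
lemma fderiv_fderiv_apply_comm {E : Type*} [NormedAddCommGroup E] [NormedSpace ℝ E] {f : E → ℝ}
    (hf : ContDiff ℝ 2 f) (q v w : E) :
    fderiv ℝ (fun r => fderiv ℝ f r v) q w = fderiv ℝ (fun r => fderiv ℝ f r w) q v := by
  have hd : DifferentiableAt ℝ (fderiv ℝ f) q :=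
    (hf.fderiv_right (m := 1) (by norm_num)).differentiable one_ne_zero q
  have hs : IsSymmSndFDerivAt ℝ f q := hf.contDiffAt.isSymmSndFDerivAt (by simp)
  rw [fderiv_clm_apply hd (differentiableAt_const v),
    fderiv_clm_apply hd (differentiableAt_const w)]
  simpa using hs.eq w v

lemma dX_dP_comm (hF : ContDiff ℝ 2 (uncurryThree F)) : dX (dP F) = dP (dX F) := by
  have h1 := hF.differentiable two_ne_zero
  have hX := (contDiff_dX (m := 1) hF (by norm_num)).differentiable one_ne_zero
  have hP := (contDiff_dP (m := 1) hF (by norm_num)).differentiable one_ne_zero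
  funext x y p
  have h := fderiv_fderiv_apply_comm hF (x, y, p) (0, 0, 1) (1, 0, 0)
  rw [← uncurryThree_dX h1, ← uncurryThree_dP h1] at h
  exact (hasDerivAt_fst_fderiv hP x y p).deriv.trans
    (h.trans (hasDerivAt_thd_fderiv hX x y p).deriv.symm)

lemma dY_dP_comm (hF : ContDiff ℝ 2 (uncurryThree F)) : dY (dP F) = dP (dY F) := by
  have h1 := hF.differentiable two_ne_zero
  have hY := (contDiff_dY (m := 1) hF (by norm_num)).differentiable one_ne_zero
  have hP := (contDiff_dP (m := 1) hF (by norm_num)).differentiable one_ne_zero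
  funext x y p
  have h := fderiv_fderiv_apply_comm hF (x, y, p) (0, 0, 1) (0, 1, 0)
  rw [← uncurryThree_dY h1, ← uncurryThree_dP h1] at h
  exact (hasDerivAt_snd_fderiv hP x y p).deriv.trans
    (h.trans (hasDerivAt_thd_fderiv hY x y p).deriv.symm)

end PartialDerivatives

/-- the chain 2-form `ρ` of a C⁴ right-hand side `F` is closed:
the cyclic sums of partial derivatives of its coefficient matrix vanish. -/
theorem chain_two_form_closed (F : ℝ → ℝ → ℝ → ℝ)
    (hF : ContDiff ℝ 4 (fun q : ℝ × ℝ × ℝ => F q.1 q.2.1 q.2.2)) :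
    ∀ q : Fin 5 → ℝ, ∀ i j k : Fin 5, i < j → j < k →
      pdn i (fun r => chainM F r j k) q
        + pdn j (fun r => chainM F r k i) q
        + pdn k (fun r => chainM F r i j) q = 0 := by
  have h0 : ContDiff ℝ 4 (uncurryThree F) := hF
  have hp : ContDiff ℝ 3 (uncurryThree (dP F)) := contDiff_dP h0 (by norm_num)
  have hpp : ContDiff ℝ 2 (uncurryThree (dP (dP F))) := contDiff_dP hp (by norm_num)
  have hppp : ContDiff ℝ 1 (uncurryThree (dP (dP (dP F)))) := contDiff_dP hpp (by norm_num)
  have hx : ContDiff ℝ 3 (uncurryThree (dX F)) := contDiff_dX h0 (by norm_num)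
  have hxp : ContDiff ℝ 2 (uncurryThree (dP (dX F))) := contDiff_dP hx (by norm_num)
  have hxpp : ContDiff ℝ 1 (uncurryThree (dP (dP (dX F)))) := contDiff_dP hxp (by norm_num)
  have hy : ContDiff ℝ 3 (uncurryThree (dY F)) := contDiff_dY h0 (by norm_num)
  have hyp : ContDiff ℝ 2 (uncurryThree (dP (dY F))) := contDiff_dP hy (by norm_num)
  have hypp : ContDiff ℝ 1 (uncurryThree (dP (dP (dY F)))) := contDiff_dP hyp (by norm_num)
  have cx : dX (dP (dP (dP F))) = dP (dP (dP (dX F))) := by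
    rw [dX_dP_comm hpp, dX_dP_comm (hp.of_le (by norm_num)), dX_dP_comm (h0.of_le (by norm_num))]
  have cy : dY (dP F) = dP (dY F) := dY_dP_comm (h0.of_le (by norm_num))
  have cyy : dY (dP (dP F)) = dP (dP (dY F)) := by
    rw [dY_dP_comm (hp.of_le (by norm_num)), cy]
  have cyyy : dY (dP (dP (dP F))) = dP (dP (dP (dY F))) := by rw [dY_dP_comm hpp, cyy]
  have d0 := h0.differentiable (by norm_num)
  have dp := hp.differentiable (by norm_num)
  have dpp := hpp.differentiable (by norm_num)
  have dppp := hppp.differentiable (by norm_num)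
  have dxpp := hxpp.differentiable (by norm_num)
  have dy := hy.differentiable (by norm_num)
  have dyp := hyp.differentiable (by norm_num)
  have dypp := hypp.differentiable (by norm_num)
  intro q i j k hij hjk
  fin_cases i <;> fin_cases j <;> first | exact absurd hij (by decide) | skip
  all_goals fin_cases k <;> first | exact absurd hjk (by decide) | skip
  all_goals simp [pdn, chainM, Function.update, -one_div]
  · have e₁ := (hasDerivAt_dX dppp (q 0) (q 1) (q 2)).deriv
    have e₂ := ((hasDerivAt_dY dppp (q 0) (q 1) (q 2)).const_mul (1 / 6 * q 2)).fun_sub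
      ((((hasDerivAt_dY dpp (q 0) (q 1) (q 2)).const_mul (1 / 2)).const_add (q 3 * q 4)).fun_add
        ((hasDerivAt_dY dp (q 0) (q 1) (q 2)).const_mul (q 3)))
    have e₃ := ((((hasDerivAt_dP dxpp (q 0) (q 1) (q 2)).const_mul (1 / 6)).fun_neg.fun_add
      ((hasDerivAt_dP dyp (q 0) (q 1) (q 2)).const_mul (2 / 3))).fun_add
        ((hasDerivAt_dP dy (q 0) (q 1) (q 2)).const_mul (q 3))).fun_sub
          (((hasDerivAt_id' (q 2)).const_mul (1 / 6)).fun_mul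
            (hasDerivAt_dP dypp (q 0) (q 1) (q 2)))
    rw [e₁, e₂.deriv, e₃.deriv, cx, cy, cyy, cyyy]
    ring
  · exact neg_add_cancel (dY F (q 0) (q 1) (q 2))
  · have e := (hasDerivAt_dP d0 (q 0) (q 1) (q 2)).fun_neg.fun_add
      ((hasDerivAt_id' (q 2)).mul_const (q 4)).fun_neg
    rw [e.deriv]
    ring
end
end

section
/- Let F : ℝ³ → ℝ be a C⁴ function of (x,y,p) and let M : ℝ⁵ → ℝ^{5×5} be the antisymmetric coefficient matrix of the chain 2-form ρ. Then at every point of ℝ⁵ the matrix M has rank exactly 4; equivalently, ρ∧ρ ≠ 0 everywhere, i.e. ρ is a quasi-symplectic 2-form (a 2-form of maximal rank on a 5-manifold). -/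
noncomputable section

/-- The determinant of an antisymmetric matrix of odd size vanishes. -/
theorem det_eq_zero_of_transpose_eq_neg {n : Type*} [Fintype n] [DecidableEq n]
    (A : Matrix n n ℝ) (hA : A.transpose = -A) (hn : Odd (Fintype.card n)) : A.det = 0 := by
  have h := A.det_transpose
  rw [hA, Matrix.det_neg, hn.neg_one_pow] at h
  linarith

/-- The determinant of an antisymmetric `4 × 4` matrix is the square of its Pfaffian. -/
theorem det_fin_four_of_transpose_eq_neg (A : Matrix (Fin 4) (Fin 4) ℝ)
    (hA : A.transpose = -A) :
    A.det = (A 0 1 * A 2 3 - A 0 2 * A 1 3 + A 0 3 * A 1 2) ^ 2 := by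
  have h (i j : Fin 4) : A j i = -A i j := congrFun (congrFun hA i) j
  have hd (i : Fin 4) : A i i = 0 := by linarith [h i i]
  have hA' : A = !![0, A 0 1, A 0 2, A 0 3; -A 0 1, 0, A 1 2, A 1 3;
      -A 0 2, -A 1 2, 0, A 2 3; -A 0 3, -A 1 3, -A 2 3, 0] := by
    ext i j
    fin_cases i <;> fin_cases j <;> first | exact hd _ | exact h _ _ | rfl
  rw [hA']
  simp [Matrix.det_succ_row_zero, Fin.sum_univ_succ, Fin.succAbove]
  ring

/-- A singular square matrix does not have full rank. -/
theorem rank_lt_card_of_det_eq_zero {n : Type*} [Fintype n] [DecidableEq n]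
    (A : Matrix n n ℝ) (hA : A.det = 0) : A.rank < Fintype.card n := by
  obtain ⟨v, hv, hAv⟩ := Matrix.exists_mulVec_eq_zero_iff.mpr hA
  have hker : 0 < Module.finrank ℝ (LinearMap.ker A.mulVecLin) := by
    rw [Module.finrank_pos_iff_exists_ne_zero]
    exact ⟨⟨v, by simpa using hAv⟩, fun h => hv (congrArg Subtype.val h)⟩
  have hsum := A.mulVecLin.finrank_range_add_finrank_ker
  rw [Module.finrank_fintype_fun_eq_card] at hsum
  rw [Matrix.rank]
  omega

/-- A nonzero minor of size `k` bounds the rank below by `k`. -/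
theorem le_rank_of_det_submatrix_ne_zero {m n : Type*} [Fintype n] {k : ℕ}
    (A : Matrix m n ℝ) (r : Fin k → m) (c : Fin k → n) (h : (A.submatrix r c).det ≠ 0) :
    k ≤ A.rank := by
  simpa [Matrix.rank_of_det_ne_zero h] using A.rank_submatrix_le r c

theorem chainM_transpose (F : ℝ → ℝ → ℝ → ℝ) (q : Fin 5 → ℝ) :
    (chainM F q).transpose = -chainM F q := by
  ext i j
  fin_cases i <;> fin_cases j <;> simp [chainM]

/-- The principal minor of the chain matrix on the coordinates `(y, p, b₁, b₂)`. -/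
theorem det_chainM_submatrix_ypbb (F : ℝ → ℝ → ℝ → ℝ) (q : Fin 5 → ℝ) :
    ((chainM F q).submatrix ![1, 2, 3, 4] ![1, 2, 3, 4]).det = q 3 ^ 2 := by
  rw [det_fin_four_of_transpose_eq_neg _
    (by rw [Matrix.transpose_submatrix, chainM_transpose]; rfl)]
  simp [chainM]

/-- The principal minor of the chain matrix on the coordinates `(x, p, b₁, b₂)`. -/
theorem det_chainM_submatrix_xpbb (F : ℝ → ℝ → ℝ → ℝ) (q : Fin 5 → ℝ) :
    ((chainM F q).submatrix ![0, 2, 3, 4] ![0, 2, 3, 4]).det = (q 2 * q 3 + 1) ^ 2 := by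
  rw [det_fin_four_of_transpose_eq_neg _
    (by rw [Matrix.transpose_submatrix, chainM_transpose]; rfl)]
  simp [chainM]
  ring

/-- the coefficient matrix of the chain 2-form `ρ` has rank exactly 4
at every point of `ℝ⁵`; i.e. `ρ` is a quasi-symplectic 2-form. -/
theorem chain_two_form_max_rank (F : ℝ → ℝ → ℝ → ℝ)
    (hF : ContDiff ℝ 4 (fun q : ℝ × ℝ × ℝ => F q.1 q.2.1 q.2.2)) :
    ∀ q : Fin 5 → ℝ, (chainM F q).rank = 4 := by
  intro q
  apply le_antisymm
  · have h := rank_lt_card_of_det_eq_zero _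
      (det_eq_zero_of_transpose_eq_neg _ (chainM_transpose F q) (by decide))
    rw [Fintype.card_fin] at h
    omega
  · by_cases hb : q 3 = 0
    · apply le_rank_of_det_submatrix_ne_zero _ ![0, 2, 3, 4] ![0, 2, 3, 4]
      rw [det_chainM_submatrix_xpbb, hb]
      norm_num
    · apply le_rank_of_det_submatrix_ne_zero _ ![1, 2, 3, 4] ![1, 2, 3, 4]
      rw [det_chainM_submatrix_ypbb]
      exact pow_ne_zero 2 hb
end
end

section
/- Let F : ℝ³ → ℝ be a C⁴ function of (x,y,p) and let M : ℝ⁵ → ℝ^{5×5} be the antisymmetric coefficient matrix of the chain 2-form ρ. At every point (x,y,p,b₁,b₂) of ℝ⁵ with b₁ ≠ 0 there exist real numbers v₄, v₅ such that the vector v = (b₁, p·b₁ + 1, F·b₁ − b₂, v₄, v₅) satisfies M·v = 0; i.e. the characteristic direction of ρ projects to the direction (1, (p·b₁+1)/b₁, (F·b₁−b₂)/b₁) in the coordinates (x,y,p). -/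
noncomputable section

/-- at every point with `b₁ ≠ 0`, the vector
`(b₁, p·b₁ + 1, F·b₁ − b₂, v₄, v₅)` is, for suitable `v₄, v₅`, a characteristic vector of
the chain 2-form `ρ`; i.e. the characteristic direction of `ρ` projects to the direction
`(1, (p·b₁+1)/b₁, (F·b₁−b₂)/b₁)` in the coordinates `(x, y, p)`. -/
theorem chain_two_form_characteristic_direction (F : ℝ → ℝ → ℝ → ℝ)
    (hF : ContDiff ℝ 4 (fun q : ℝ × ℝ × ℝ => F q.1 q.2.1 q.2.2))
    (q : Fin 5 → ℝ) (hb : q 3 ≠ 0) :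
    ∃ v₄ v₅ : ℝ,
      (chainM F q).mulVec
        ![q 3, q 2 * q 3 + 1, F (q 0) (q 1) (q 2) * q 3 - q 4, v₄, v₅] = 0 := by
  set v₄ : ℝ := -(chainM F q 0 2 * q 3 + chainM F q 1 2 * (q 2 * q 3 + 1)) with hv₄
  refine ⟨v₄, (-chainM F q 0 1 * q 3
    + chainM F q 1 2 * (F (q 0) (q 1) (q 2) * q 3 - q 4) - q 4 * v₄) / q 3, ?_⟩
  ext i
  fin_cases i <;>
    simp [hv₄, chainM, Matrix.mulVec, dotProduct, Fin.sum_univ_five] <;> field_simp <;> ring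
end
end

section
/- Let I ⊆ ℝ be an open interval and y, p : I → ℝ be C² functions with y'(x) − p(x) ≠ 0 for all x ∈ I, satisfying the flat chains pair y'' = 0 and p'' = 2(p')²/(p − y') on I. Define b₁ = 1/(y' − p) and b₂ = −p'/(y' − p). Then the lifted curve γ(x) = (x, y(x), p(x), b₁(x), b₂(x)) is a characteristic curve of the chain 2-form ρ for F = 0: its coefficient matrix M satisfies M(γ(x))·γ'(x) = 0 for all x ∈ I. -/
noncomputable section

/-- A function of class `C²` on an open set has a derivative which is differentiable. -/
theorem hasDerivAt_deriv_of_contDiffOn_two {f : ℝ → ℝ} {s : Set ℝ} (hs : IsOpen s)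
    (hf : ContDiffOn ℝ 2 f s) {x : ℝ} (hx : x ∈ s) :
    HasDerivAt (deriv f) (deriv (deriv f) x) x :=
  (((hf.deriv_of_isOpen (m := 1) hs (by norm_num)).differentiableOn one_ne_zero).differentiableAt
    (hs.mem_nhds hx)).hasDerivAt

/-- a solution `(y, p)` of the flat chains pair
`y'' = 0`, `p'' = 2(p')²/(p − y')`, lifted via `b₁ = 1/(y' − p)`, `b₂ = −p'/(y' − p)`,
is a characteristic curve of the chain 2-form `ρ` for `F = 0`. -/
theorem flat_chains_solution_is_characteristic_curve (a b : ℝ) (y p : ℝ → ℝ)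
    (hy : ContDiffOn ℝ 2 y (Set.Ioo a b)) (hp : ContDiffOn ℝ 2 p (Set.Ioo a b))
    (hne : ∀ x ∈ Set.Ioo a b, deriv y x - p x ≠ 0)
    (hy'' : ∀ x ∈ Set.Ioo a b, deriv (deriv y) x = 0)
    (hp'' : ∀ x ∈ Set.Ioo a b,
      deriv (deriv p) x = 2 * (deriv p x) ^ 2 / (p x - deriv y x)) :
    ∀ x ∈ Set.Ioo a b,
      (chainM (fun _ _ _ => (0 : ℝ))
          ![x, y x, p x, 1 / (deriv y x - p x), -(deriv p x) / (deriv y x - p x)]).mulVec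
        ![1, deriv y x, deriv p x,
          deriv (fun t => 1 / (deriv y t - p t)) x,
          deriv (fun t => -(deriv p t) / (deriv y t - p t)) x] = 0 := by
  intro x hx
  have hd := hne x hx
  have hy₂ := hasDerivAt_deriv_of_contDiffOn_two isOpen_Ioo hy hx
  have hp₁ : HasDerivAt p (deriv p x) x :=
    ((hp.differentiableOn two_ne_zero).differentiableAt (isOpen_Ioo.mem_nhds hx)).hasDerivAt
  have hp₂ := hasDerivAt_deriv_of_contDiffOn_two isOpen_Ioo hp hx
  rw [hy'' x hx] at hy₂
  have hb₁ : deriv (fun t => 1 / (deriv y t - p t)) x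
      = deriv p x / (deriv y x - p x) ^ 2 := by
    refine (((hasDerivAt_const x (1 : ℝ)).fun_div (hy₂.fun_sub hp₁) hd).congr_deriv ?_).deriv
    ring
  have hb₂ : deriv (fun t => -(deriv p t) / (deriv y t - p t)) x
      = deriv p x ^ 2 / (deriv y x - p x) ^ 2 := by
    refine ((hp₂.fun_neg.fun_div (hy₂.fun_sub hp₁) hd).congr_deriv ?_).deriv
    rw [hp'' x hx, ← neg_sub (deriv y x) (p x)]
    field_simp
    ring
  rw [hb₁, hb₂]
  ext i
  fin_cases i <;>
    simp [chainM, dX, dY, dP, Matrix.mulVec, dotProduct, Fin.sum_univ_five] <;>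
    field_simp <;> ring
end
end

section
/- Let I ⊆ ℝ be an open interval and y, p : I → ℝ be C³ functions such that Δ(x) := y'(x)·x + p'(x) − y(x) ≠ 0 for all x ∈ I, and suppose y'' = ((y')² + 1)²/Δ and p'' = ((y')² + 1)(p'y' − y·y' − x)/Δ on I. Then y satisfies the third order ODE y''' = 3y'(y'')²/(1 + (y')²) on I. -/
/-- a solution `(y, p)` of the flat CR chains pair
`y'' = ((y')² + 1)²/Δ`, `p'' = ((y')² + 1)(p'y' − y·y' − x)/Δ`, where
`Δ = y'·x + p' − y ≠ 0`, satisfies the third order ODE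
`y''' = 3y'(y'')²/(1 + (y')²)`. -/
theorem flat_CR_chains_pair_gives_third_order_ODE (a b : ℝ) (y p : ℝ → ℝ)
    (hy : ContDiffOn ℝ 3 y (Set.Ioo a b)) (hp : ContDiffOn ℝ 3 p (Set.Ioo a b))
    (hΔ : ∀ x ∈ Set.Ioo a b, deriv y x * x + deriv p x - y x ≠ 0)
    (hy'' : ∀ x ∈ Set.Ioo a b,
      deriv (deriv y) x
        = ((deriv y x) ^ 2 + 1) ^ 2 / (deriv y x * x + deriv p x - y x))
    (hp'' : ∀ x ∈ Set.Ioo a b,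
      deriv (deriv p) x
        = ((deriv y x) ^ 2 + 1) * (deriv p x * deriv y x - y x * deriv y x - x)
            / (deriv y x * x + deriv p x - y x)) :
    ∀ x ∈ Set.Ioo a b,
      deriv (deriv (deriv y)) x
        = 3 * deriv y x * (deriv (deriv y) x) ^ 2 / (1 + (deriv y x) ^ 2) := by
  intro x hx
  have differentiableAt_and_deriv {f : ℝ → ℝ} (hf : ContDiffOn ℝ 3 f (Set.Ioo a b)) :
      DifferentiableAt ℝ f x ∧ DifferentiableAt ℝ (deriv f) x := by
    have hx' := isOpen_Ioo.mem_nhds hx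
    have hf' : ContDiffOn ℝ 2 (deriv f) (Set.Ioo a b) :=
      hf.deriv_of_isOpen isOpen_Ioo (by norm_num)
    exact ⟨(hf.contDiffAt hx').differentiableAt (by norm_num),
      (hf'.contDiffAt hx').differentiableAt (by norm_num)⟩
  obtain ⟨dy, dy'⟩ := differentiableAt_and_deriv hy
  obtain ⟨-, dp'⟩ := differentiableAt_and_deriv hp
  have hΔ_deriv := ((dy'.hasDerivAt.mul (hasDerivAt_id x)).add dp'.hasDerivAt).sub dy.hasDerivAt
  have hΔx := hΔ x hx
  have hquot := (((dy'.hasDerivAt.pow 2).add_const 1).pow 2).div hΔ_deriv hΔx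
  have heq := Filter.eventually_of_mem (isOpen_Ioo.mem_nhds hx) hy''
  have hthird := (hquot.congr_of_eventuallyEq heq).deriv
  have hpos : 1 + deriv y x ^ 2 ≠ 0 := by positivity
  simp only [Pi.add_apply, Pi.sub_apply, Pi.mul_apply, Pi.pow_apply, id] at hthird
  rw [hthird, hp'' x hx, hy'' x hx]
  generalize deriv y x = q at *
  generalize deriv p x = r at *
  field_simp
  ring
end

section
/- Consider the flat chains pair with F¹ = 0 and F²(t,z¹,z²,p¹,p²) = 2(p²)²/(z² − p¹), defined on the open set where z² ≠ p¹. Then the Fels torsion of this pair of second order ODEs vanishes identically: T^i_j = 0 for all i, j ∈ {1,2} at every point of the domain. -/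
noncomputable section

/-- Coordinates on `ℝ⁵` are `(t, z¹, z², p¹, p²)`: index of `zⁱ`. -/
def zIdx : Fin 2 → Fin 5 := ![1, 2]

/-- Index of `pⁱ` among the coordinates `(t, z¹, z², p¹, p²)`. -/
def pIdx : Fin 2 → Fin 5 := ![3, 4]

/-- The total derivative vector field of the pair of second order ODEs
`(zⁱ)'' = Fⁱ(t, z¹, z², p¹, p²)`, applied to a function `f`:
`D f = ∂_t f + p¹∂_{z¹} f + p²∂_{z²} f + F¹∂_{p¹} f + F²∂_{p²} f`. -/
def totalDeriv (F : Fin 2 → (Fin 5 → ℝ) → ℝ) (f : (Fin 5 → ℝ) → ℝ)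
    (q : Fin 5 → ℝ) : ℝ :=
  pdn 0 f q + q 3 * pdn 1 f q + q 4 * pdn 2 f q
    + F 0 q * pdn 3 f q + F 1 q * pdn 4 f q

/-- `Fⁱⱼ = −∂Fⁱ/∂zʲ + (1/2)·D(∂Fⁱ/∂pʲ) − (1/4)·Σₖ (∂Fⁱ/∂pᵏ)(∂Fᵏ/∂pʲ)`. -/
def felsF (F : Fin 2 → (Fin 5 → ℝ) → ℝ) (i j : Fin 2) (q : Fin 5 → ℝ) : ℝ :=
  -(pdn (zIdx j) (F i) q)
    + (1/2) * totalDeriv F (fun r => pdn (pIdx j) (F i) r) q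
    - (1/4) * ∑ k : Fin 2, pdn (pIdx k) (F i) q * pdn (pIdx j) (F k) q

/-- The Fels torsion `Tⁱⱼ = Fⁱⱼ − (1/2)δⁱⱼ(F¹₁ + F²₂)` of a pair of second order ODEs. -/
def felsT (F : Fin 2 → (Fin 5 → ℝ) → ℝ) (i j : Fin 2) (q : Fin 5 → ℝ) : ℝ :=
  felsF F i j q
    - (1/2) * (if i = j then (1 : ℝ) else 0) * (felsF F 0 0 q + felsF F 1 1 q)

/-- A one-variable derivative along the `i`-th coordinate line computes `pdn`. -/
theorem pdn_eq_of_hasDerivAt {n : ℕ} {i : Fin n} {f : (Fin n → ℝ) → ℝ} {q : Fin n → ℝ} {d : ℝ}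
    (h : HasDerivAt (fun t => f (Function.update q i t)) d (q i)) : pdn i f q = d :=
  h.deriv

theorem pdn_const {n : ℕ} (i : Fin n) (c : ℝ) (q : Fin n → ℝ) : pdn i (fun _ => c) q = 0 := by
  simp [pdn]

/-- The partial derivatives of `c (p²)ᵐ / (z² - p¹)ᵏ`, at points where `z² ≠ p¹`. -/
theorem pdn_mul_pow_div_pow (c : ℝ) (m k : ℕ) (i : Fin 5) (q : Fin 5 → ℝ) (hq : q 2 ≠ q 3) :
    pdn i (fun r => c * r 4 ^ m / (r 2 - r 3) ^ k) q =
      ![0, 0, -(c * k * q 4 ^ m / (q 2 - q 3) ^ (k + 1)),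
        c * k * q 4 ^ m / (q 2 - q 3) ^ (k + 1),
        c * m * q 4 ^ (m - 1) / (q 2 - q 3) ^ k] i := by
  have hu : q 2 - q 3 ≠ 0 := sub_ne_zero.mpr hq
  apply pdn_eq_of_hasDerivAt
  have hc : ∀ j : Fin 5, HasDerivAt (fun t => Function.update q i t j)
      (if j = i then 1 else 0) (q i) := by
    intro j
    by_cases hj : j = i
    · subst hj
      simpa using hasDerivAt_id' (q j)
    · simpa [hj] using hasDerivAt_const (q i) (q j)
  have hu' : (Function.update q i (q i) 2 - Function.update q i (q i) 3) ^ k ≠ 0 := by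
    simpa using pow_ne_zero k hu
  refine ((((hc 4).fun_pow m).const_mul c).fun_div
    (((hc 2).fun_sub (hc 3)).fun_pow k) hu').congr_deriv ?_
  rcases k with _ | k <;> fin_cases i <;> simp <;> field_simp <;> ring

/-- The partial derivatives of `2 (p²)² / (z² - p¹)` in `p¹`, valid also at the junk points. -/
theorem pdn_three_flat_chains :
    (fun r => pdn 3 (fun r : Fin 5 → ℝ => 2 * r 4 ^ 2 / (r 2 - r 3)) r) =
      fun r => 2 * r 4 ^ 2 / (r 2 - r 3) ^ 2 := by
  funext r
  simp [pdn, div_eq_mul_inv, deriv_comp_const_sub (f := fun x : ℝ => x⁻¹)]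

theorem pdn_four_flat_chains :
    (fun r => pdn 4 (fun r : Fin 5 → ℝ => 2 * r 4 ^ 2 / (r 2 - r 3)) r) =
      fun r => 4 * r 4 / (r 2 - r 3) := by
  funext r
  simp [pdn]
  ring

/-- the Fels torsion of the flat chains pair
`(z¹)'' = 0`, `(z²)'' = 2(p²)²/(z² − p¹)` vanishes identically on the open set
`z² ≠ p¹`. -/
theorem flat_chains_pair_torsion_free :
    ∀ q : Fin 5 → ℝ, q 2 ≠ q 3 → ∀ i j : Fin 2,
      felsT ![fun _ => (0 : ℝ), fun r => 2 * (r 4) ^ 2 / (r 2 - r 3)] i j q = 0 := by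
  intro q hq
  have hu : q 2 - q 3 ≠ 0 := sub_ne_zero.mpr hq
  have h2 := fun i => pdn_mul_pow_div_pow 2 2 1 i q hq
  have h4 := fun i => pdn_mul_pow_div_pow 4 1 1 i q hq
  simp only [pow_one] at h2 h4
  have hF : ∀ i j : Fin 2, felsF ![fun _ => (0 : ℝ),
      fun r => 2 * (r 4) ^ 2 / (r 2 - r 3)] i j q = 0 := by
    intro i j
    fin_cases i <;> fin_cases j <;>
      simp [felsF, totalDeriv, zIdx, pIdx, Fin.sum_univ_two, pdn_const, pdn_three_flat_chains,
        pdn_four_flat_chains, h2, h4, pdn_mul_pow_div_pow _ _ _ _ q hq] <;>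
      field_simp <;> ring
  intro i j
  simp [felsT, hF]
end
end

section
/- Let t̂, ẑ, â, b̂ ∈ ℝ satisfy the non-incidence condition k := b̂·t̂ + â − ẑ ≠ 0, and let I ⊆ ℝ be an open interval with t̂ ∉ I. Define z(t) = b̂·t + â and b(t) = b̂ + k/(t − t̂) for t ∈ I. Then z'(t) − b(t) ≠ 0 on I and the pair (z, b) solves the dancing pair of the flat path geometry: z'' = 0 and b'' = −2(b')²/(z' − b) on I. -/
/-- First derivative of a translated hyperbola away from its pole. -/
theorem hasDerivAt_add_div_sub (b k p : ℝ) {t : ℝ} (ht : t ≠ p) :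
    HasDerivAt (fun s => b + k / (s - p)) (-k / (t - p) ^ 2) t := by
  have h := (((hasDerivAt_const t k).div ((hasDerivAt_id t).sub_const p)
    (sub_ne_zero.2 ht)).const_add b)
  simpa using h

open Filter Topology in
/-- Second derivative of a translated hyperbola away from its pole. -/
theorem deriv_deriv_add_div_sub (b k p : ℝ) {t : ℝ} (ht : t ≠ p) :
    deriv (deriv (fun s => b + k / (s - p))) t = 2 * k / (t - p) ^ 3 := by
  have hu : t - p ≠ 0 := sub_ne_zero.2 ht
  have heq : deriv (fun s => b + k / (s - p)) =ᶠ[𝓝 t] fun s => -k / (s - p) ^ 2 := by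
    filter_upwards [isOpen_ne.mem_nhds ht] with s hs
    exact (hasDerivAt_add_div_sub b k p hs).deriv
  have h := (hasDerivAt_const t (-k)).div (((hasDerivAt_id t).sub_const p).pow 2)
    (pow_ne_zero 2 hu)
  rw [heq.deriv_eq]
  refine h.deriv.trans ?_
  simp only [Pi.pow_apply, id]
  field_simp
  norm_num
  ring

/-- Derivative of an affine function. -/
theorem deriv_mul_add_const (a b : ℝ) : deriv (fun s : ℝ => b * s + a) = fun _ => b := by
  funext t
  simp

/-- for a non-incident pair `(t̂, ẑ) ∈ M`, `(â, b̂) ∈ T`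
(i.e. `k := b̂·t̂ + â − ẑ ≠ 0`), the explicit curve `z(t) = b̂·t + â`,
`b(t) = b̂ + k/(t − t̂)` solves the dancing pair of the flat path geometry:
`z'' = 0`, `b'' = −2(b')²/(z' − b)`, with `z' − b ≠ 0`, on any open interval
avoiding `t̂`. -/
theorem flat_dancing_paths_explicit (that zhat ahat bhat : ℝ)
    (hk : bhat * that + ahat - zhat ≠ 0)
    (c d : ℝ) (hI : that ∉ Set.Ioo c d) :
    ∀ t ∈ Set.Ioo c d,
      deriv (fun s => bhat * s + ahat) t
          - (bhat + (bhat * that + ahat - zhat) / (t - that)) ≠ 0 ∧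
      deriv (deriv (fun s => bhat * s + ahat)) t = 0 ∧
      deriv (deriv (fun s => bhat + (bhat * that + ahat - zhat) / (s - that))) t
        = -2 * (deriv (fun s => bhat + (bhat * that + ahat - zhat) / (s - that)) t) ^ 2
            / (deriv (fun s => bhat * s + ahat) t
                - (bhat + (bhat * that + ahat - zhat) / (t - that))) := by
  intro t ht
  have htp : t ≠ that := fun h => hI (h ▸ ht)
  have hu : t - that ≠ 0 := sub_ne_zero.2 htp
  rw [deriv_deriv_add_div_sub _ _ _ htp, (hasDerivAt_add_div_sub _ _ _ htp).deriv,
    deriv_mul_add_const]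
  generalize bhat * that + ahat - zhat = k at hk ⊢
  simp only [sub_add_cancel_left, deriv_const, true_and]
  refine ⟨neg_ne_zero.2 (div_ne_zero hk hu), ?_⟩
  field_simp
end

section
/- On the open set {(y,p,Y,P) ∈ ℝ⁴ : Δ := Y − p ≠ 0}, define the covectors η¹ = dY, η² = Δ⁻⁴(−ΔP dY + Δ² dP − P² dy + 2ΔP dp), η³ = dy, η⁴ = Δ⁻³(−P dy + Δ dp), and the covectors η̃¹ = dY, η̃² = dP − (P²/Δ²) dy + (2P/Δ) dp, η̃³ = dy, η̃⁴ = dp. Then at every point of this open set the symmetric bilinear forms satisfy η¹⊙η⁴ − η²⊙η³ = Δ⁻² (η̃¹⊙η̃⁴ − η̃²⊙η̃³), where (α⊙β)(u,v) = (α(u)β(v) + α(v)β(u))/2. In particular the two quadratic forms are conformally equivalent. -/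
noncomputable section

/- Coordinates on `ℝ⁴` are `(y, p, Y, P)` at indices `0, 1, 2, 3`, and `Δ = Y − p`. -/

/-- `η¹ = dY`. -/
def eta1 (q : Fin 4 → ℝ) : Fin 4 → ℝ := ![0, 0, 1, 0]

/-- `η² = Δ⁻⁴(−ΔP dY + Δ² dP − P² dy + 2ΔP dp)`. -/
def eta2 (q : Fin 4 → ℝ) : Fin 4 → ℝ :=
  ![-(q 3) ^ 2 / (q 2 - q 1) ^ 4, 2 * q 3 / (q 2 - q 1) ^ 3,
    -(q 3) / (q 2 - q 1) ^ 3, 1 / (q 2 - q 1) ^ 2]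

/-- `η³ = dy`. -/
def eta3 (q : Fin 4 → ℝ) : Fin 4 → ℝ := ![1, 0, 0, 0]

/-- `η⁴ = Δ⁻³(−P dy + Δ dp)`. -/
def eta4 (q : Fin 4 → ℝ) : Fin 4 → ℝ :=
  ![-(q 3) / (q 2 - q 1) ^ 3, 1 / (q 2 - q 1) ^ 2, 0, 0]

/-- `η̃¹ = dY`. -/
def teta1 (q : Fin 4 → ℝ) : Fin 4 → ℝ := ![0, 0, 1, 0]

/-- `η̃² = dP − (P²/Δ²) dy + (2P/Δ) dp`. -/
def teta2 (q : Fin 4 → ℝ) : Fin 4 → ℝ :=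
  ![-(q 3) ^ 2 / (q 2 - q 1) ^ 2, 2 * q 3 / (q 2 - q 1), 0, 1]

/-- `η̃³ = dy`. -/
def teta3 (q : Fin 4 → ℝ) : Fin 4 → ℝ := ![1, 0, 0, 0]

/-- `η̃⁴ = dp`. -/
def teta4 (q : Fin 4 → ℝ) : Fin 4 → ℝ := ![0, 1, 0, 0]

/-- The symmetric product `(α⊙β)(u,v) = (α(u)β(v) + α(v)β(u))/2` of two covectors. -/
def symProd (α β u v : Fin 4 → ℝ) : ℝ :=
  ((∑ i, α i * u i) * (∑ i, β i * v i) + (∑ i, α i * v i) * (∑ i, β i * u i)) / 2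

/-- on the open set `Δ = Y − p ≠ 0`, the symmetric bilinear forms satisfy
`η¹⊙η⁴ − η²⊙η³ = Δ⁻²(η̃¹⊙η̃⁴ − η̃²⊙η̃³)`; in particular the two quadratic forms are
conformally equivalent. -/
theorem adapted_coframe_conformal_to_dancing_metric :
    ∀ q : Fin 4 → ℝ, q 2 - q 1 ≠ 0 → ∀ u v : Fin 4 → ℝ,
      symProd (eta1 q) (eta4 q) u v - symProd (eta2 q) (eta3 q) u v
        = (1 / (q 2 - q 1) ^ 2) *
            (symProd (teta1 q) (teta4 q) u v - symProd (teta2 q) (teta3 q) u v) := by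
  intro q hq u v
  simp only [symProd, eta1, eta2, eta3, eta4, teta1, teta2, teta3, teta4, Fin.sum_univ_four,
    Matrix.cons_val]
  field_simp
  ring
end
end

section
/- On the open set {(y,p,Y,P) ∈ ℝ⁴ : Δ := Y − p ≠ 0}, the 2-form ω = η¹∧η⁴ + η²∧η³, where η¹ = dY, η² = Δ⁻⁴(−ΔP dY + Δ² dP − P² dy + 2ΔP dp), η³ = dy, η⁴ = Δ⁻³(−P dy + Δ dp), equals −(2P/Δ³) dY∧dy + (1/Δ²) dY∧dp + (1/Δ²) dP∧dy − (2P/Δ³) dy∧dp and is closed: the cyclic sums of partial derivatives of its antisymmetric coefficient matrix vanish identically on this open set. -/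
noncomputable section

/-- The antisymmetric coefficient matrix of the wedge product `α ∧ β` of two covectors. -/
def wedge (α β : Fin 4 → ℝ) : Matrix (Fin 4) (Fin 4) ℝ :=
  Matrix.of fun i j => α i * β j - α j * β i

/-- The coefficient matrix of the 2-form `ω = η¹∧η⁴ + η²∧η³`. -/
def omegaMat (q : Fin 4 → ℝ) : Matrix (Fin 4) (Fin 4) ℝ :=
  wedge (eta1 q) (eta4 q) + wedge (eta2 q) (eta3 q)

/-- The coefficient matrix of
`−(2P/Δ³) dY∧dy + (1/Δ²) dY∧dp + (1/Δ²) dP∧dy − (2P/Δ³) dy∧dp`. -/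
def targetMat (q : Fin 4 → ℝ) : Matrix (Fin 4) (Fin 4) ℝ :=
  let Δ := q 2 - q 1
  let P := q 3
  !![0, -2 * P / Δ ^ 3, 2 * P / Δ ^ 3, -1 / Δ ^ 2;
     2 * P / Δ ^ 3, 0, -1 / Δ ^ 2, 0;
     -2 * P / Δ ^ 3, 1 / Δ ^ 2, 0, 0;
     1 / Δ ^ 2, 0, 0, 0]

theorem omegaMat_eq_targetMat (q : Fin 4 → ℝ) : omegaMat q = targetMat q := by
  ext i j
  fin_cases i <;> fin_cases j <;>
    simp [omegaMat, targetMat, wedge, eta1, eta2, eta3, eta4] <;> ring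

/-- The coefficient matrix of `-2 (dY∧dy + dy∧dp)`. -/
def cubicPart : Matrix (Fin 4) (Fin 4) ℝ :=
  !![0, -2, 2, 0; 2, 0, 0, 0; -2, 0, 0, 0; 0, 0, 0, 0]

/-- The coefficient matrix of `dY∧dp + dP∧dy`. -/
def quadraticPart : Matrix (Fin 4) (Fin 4) ℝ :=
  !![0, 0, 0, -1; 0, 0, -1, 0; 0, 1, 0, 0; 1, 0, 0, 0]

theorem omegaMat_apply (q : Fin 4 → ℝ) (i j : Fin 4) :
    omegaMat q i j = cubicPart i j * (q 3 * ((q 2 - q 1) ^ 3)⁻¹)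
      + quadraticPart i j * ((q 2 - q 1) ^ 2)⁻¹ := by
  rw [omegaMat_eq_targetMat]
  fin_cases i <;> fin_cases j <;>
    simp [targetMat, cubicPart, quadraticPart] <;> ring

theorem hasDerivAt_update_apply {n : ℕ} (q : Fin n → ℝ) (i j : Fin n) :
    HasDerivAt (fun t => Function.update q i t j) ((Pi.single i 1 : Fin n → ℝ) j) (q i) :=
  hasDerivAt_pi.1 (hasDerivAt_update q i (q i)) j

theorem pdn_omegaMat (q : Fin 4 → ℝ) (hq : q 2 - q 1 ≠ 0) (i j k : Fin 4) :
    pdn i (fun r => omegaMat r j k) q =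
      cubicPart j k * ![0, 3 * q 3 / (q 2 - q 1) ^ 4, -3 * q 3 / (q 2 - q 1) ^ 4,
        1 / (q 2 - q 1) ^ 3] i
      + quadraticPart j k * ![0, 2 / (q 2 - q 1) ^ 3, -2 / (q 2 - q 1) ^ 3, 0] i := by
  have hP := hasDerivAt_update_apply q i 3
  have hΔ := (hasDerivAt_update_apply q i 2).sub (hasDerivAt_update_apply q i 1)
  have h := ((hP.mul ((hΔ.pow 3).inv (by simpa using hq))).const_mul (cubicPart j k)).add
    (((hΔ.pow 2).inv (by simpa using hq)).const_mul (quadraticPart j k))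
  simp only [pdn, omegaMat_apply]
  refine (HasDerivAt.deriv h).trans ?_
  fin_cases i <;> simp <;> field_simp

/-- on the open set `Δ = Y − p ≠ 0`, the 2-form `ω = η¹∧η⁴ + η²∧η³`
equals `−(2P/Δ³) dY∧dy + (1/Δ²) dY∧dp + (1/Δ²) dP∧dy − (2P/Δ³) dy∧dp` and is closed:
the cyclic sums of partial derivatives of its antisymmetric coefficient matrix vanish. -/
theorem para_Kahler_symplectic_form_closed :
    ∀ q : Fin 4 → ℝ, q 2 - q 1 ≠ 0 →
      omegaMat q = targetMat q ∧
      ∀ i j k : Fin 4,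
        pdn i (fun r => omegaMat r j k) q + pdn j (fun r => omegaMat r k i) q
          + pdn k (fun r => omegaMat r i j) q = 0 := by
  intro q hq
  refine ⟨omegaMat_eq_targetMat q, fun i j k => ?_⟩
  simp only [pdn_omegaMat q hq]
  fin_cases i <;> fin_cases j <;> fin_cases k <;>
    simp [cubicPart, quadraticPart] <;> ring
end
end

section
/- On the open set {(y,p,Y,P) ∈ ℝ⁴ : Δ := Y − p ≠ 0}, define the vector fields u₁ = Δ∂_y + P∂_p − (P²/Δ)∂_P and u₂ = Δ∂_Y + P∂_P, and the covectors η² = Δ⁻⁴(−ΔP dY + Δ² dP − P² dy + 2ΔP dp) and η⁴ = Δ⁻³(−P dy + Δ dp). Then η²(u₁) = η²(u₂) = η⁴(u₁) = η⁴(u₂) = 0 at every point, and the Lie bracket satisfies [u₁, u₂] = −u₁ − (P/Δ)·u₂; in particular the rank 2 distribution ker{η², η⁴} is integrable. -/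
noncomputable section

/-- The vector field `u₁ = Δ∂_y + P∂_p − (P²/Δ)∂_P`. -/
def u1 (q : Fin 4 → ℝ) : Fin 4 → ℝ :=
  ![q 2 - q 1, q 3, 0, -(q 3) ^ 2 / (q 2 - q 1)]

/-- The vector field `u₂ = Δ∂_Y + P∂_P`. -/
def u2 (q : Fin 4 → ℝ) : Fin 4 → ℝ := ![0, 0, q 2 - q 1, q 3]

/-- The Lie bracket `[u, v]ⁱ = Σⱼ (uʲ ∂ⱼvⁱ − vʲ ∂ⱼuⁱ)` of two vector fields on `ℝ⁴`. -/
def lieB (u v : (Fin 4 → ℝ) → Fin 4 → ℝ) (q : Fin 4 → ℝ) (i : Fin 4) : ℝ :=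
  ∑ j, (u q j * pdn j (fun r => v r i) q - v q j * pdn j (fun r => u r i) q)

theorem pdn_eq_of_hasFDerivAt {n : ℕ} {f : (Fin n → ℝ) → ℝ} {f' : (Fin n → ℝ) →L[ℝ] ℝ}
    {q : Fin n → ℝ} (hf : HasFDerivAt f f' q) (i : Fin n) :
    pdn i f q = f' (Pi.single i 1) := by
  have hf' : HasFDerivAt f f' (Function.update q i (q i)) := by
    rwa [Function.update_eq_self]
  exact (hf'.comp_hasDerivAt (q i) (hasDerivAt_update q i (q i))).deriv

theorem hasFDerivAt_coord {n : ℕ} (k : Fin n) (q : Fin n → ℝ) :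
    HasFDerivAt (fun r : Fin n → ℝ => r k) (ContinuousLinearMap.proj (R := ℝ) k) q :=
  hasFDerivAt_apply k q

theorem pdn_coord {n : ℕ} (i k : Fin n) (q : Fin n → ℝ) :
    pdn i (fun r => r k) q = (Pi.single i 1 : Fin n → ℝ) k := by
  rw [pdn_eq_of_hasFDerivAt (hasFDerivAt_coord k q)]
  rfl

theorem pdn_coord_sub {n : ℕ} (i k l : Fin n) (q : Fin n → ℝ) :
    pdn i (fun r => r k - r l) q =
      (Pi.single i 1 : Fin n → ℝ) k - (Pi.single i 1 : Fin n → ℝ) l := by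
  rw [pdn_eq_of_hasFDerivAt ((hasFDerivAt_coord k q).fun_sub (hasFDerivAt_coord l q))]
  rfl

theorem pdn_neg_sq_div_sub {n : ℕ} (i j k l : Fin n) (q : Fin n → ℝ) (h : q k - q l ≠ 0) :
    pdn i (fun r => -(r j) ^ 2 / (r k - r l)) q =
      -(2 * q j * (Pi.single i 1 : Fin n → ℝ) j) / (q k - q l) +
        q j ^ 2 * ((Pi.single i 1 : Fin n → ℝ) k - (Pi.single i 1 : Fin n → ℝ) l) /
          (q k - q l) ^ 2 := by
  have hd := ((hasFDerivAt_coord j q).pow 2).neg.mul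
    ((hasDerivAt_inv h).comp_hasFDerivAt q
      ((hasFDerivAt_coord k q).fun_sub (hasFDerivAt_coord l q)))
  refine (pdn_eq_of_hasFDerivAt hd i).trans ?_
  simp
  field_simp
  ring

/-- on the open set `Δ = Y − p ≠ 0`, the vector fields `u₁, u₂` annihilate
the covectors `η²` and `η⁴`, and `[u₁, u₂] = −u₁ − (P/Δ)·u₂`; in particular the rank 2
distribution `ker{η², η⁴}` is integrable. -/
theorem para_antiholomorphic_distribution_integrable :
    ∀ q : Fin 4 → ℝ, q 2 - q 1 ≠ 0 →
      (∑ i, eta2 q i * u1 q i) = 0 ∧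
      (∑ i, eta2 q i * u2 q i) = 0 ∧
      (∑ i, eta4 q i * u1 q i) = 0 ∧
      (∑ i, eta4 q i * u2 q i) = 0 ∧
      ∀ i, lieB u1 u2 q i = -(u1 q i) - (q 3 / (q 2 - q 1)) * u2 q i := by
  intro q h
  refine ⟨?_, ?_, ?_, ?_, ?_⟩
  · simp [Fin.sum_univ_four, eta2, u1]
    field_simp
    ring
  · simp [Fin.sum_univ_four, eta2, u2]
    field_simp
    ring
  · simp [Fin.sum_univ_four, eta4, u1]
    field_simp
    ring
  · simp [Fin.sum_univ_four, eta4, u2]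
  · intro i
    fin_cases i <;>
      simp [lieB, Fin.sum_univ_four, u1, u2, pdn_const, pdn_coord, pdn_coord_sub,
        pdn_neg_sq_div_sub _ _ _ _ q h] <;>
      field_simp
    ring
end
end
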